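/- Positivity preservation of the first-order local Lax–Friedrichs scheme with Godunov–Powell source: let γ > 1 and suppose the cell averages Ūⁿᵢⱼ ∈ 𝒢 for all (i,j) ∈ ℤ². Suppose the interface viscosity parameters satisfy α_ℓ^{LLF} ≥ max{ϱ_ℓ(U), ϱ_ℓ(Ũ), α_{ℓ,*}(U,Ũ), α_{ℓ,*}(Ũ,U)} at every interface (where U, Ũ are the two adjacent cell averages, ℓ = 1 for x-interfaces and ℓ = 2 for y-interfaces). Then under the CFL condition Δt ( α₁,ᵢ₋½,ⱼ/Δx + α₁,ᵢ₊½,ⱼ/Δx + α₂,ᵢ,ⱼ₋½/Δy + α₂,ᵢ,ⱼ₊½/Δy + |(∇·B̄ⁿ)ᵢⱼ| / √(ρ̄ⁿᵢⱼ) ) ≤ 1 for all i,j, the updated averages Ū^{LLF}ᵢⱼ = Ūⁿᵢⱼ − (Δt/Δx)(F̂₁,ᵢ₊½,ⱼ − F̂₁,ᵢ₋½,ⱼ) − (Δt/Δy)(F̂₂,ᵢ,ⱼ₊½ − F̂₂,ᵢ,ⱼ₋½) − Δt (∇·B̄ⁿ)ᵢⱼ Ψ(Ūⁿᵢⱼ)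 belong to 𝒢 for all i,j. -/

import Mathlib

noncomputable section

/-- MHD pressure of a conservative state `U = (ρ, ρv₁, ρv₂, ρv₃, B₁, B₂, B₃, E)`. -/
def mhdPressure (γ : ℝ) (U : Fin 8 → ℝ) : ℝ :=
  (γ - 1) * (U 7 - (U 1 ^ 2 + U 2 ^ 2 + U 3 ^ 2) / (2 * U 0)
    - (U 4 ^ 2 + U 5 ^ 2 + U 6 ^ 2) / 2)

/-- Admissible state set `𝒢 = {U : ρ > 0, p > 0}`. -/
def mhdAdmissible (γ : ℝ) : Set (Fin 8 → ℝ) :=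
  {U | 0 < U 0 ∧ 0 < mhdPressure γ U}

/-- Total pressure `p_t = p + |B|²/2`. -/
def mhdTotalPressure (γ : ℝ) (U : Fin 8 → ℝ) : ℝ :=
  mhdPressure γ U + (U 4 ^ 2 + U 5 ^ 2 + U 6 ^ 2) / 2

/-- `v · B`. -/
def mhdVdotB (U : Fin 8 → ℝ) : ℝ :=
  (U 1 * U 4 + U 2 * U 5 + U 3 * U 6) / U 0

/-- The ideal MHD flux in the x-direction. -/
def mhdFlux1 (γ : ℝ) (U : Fin 8 → ℝ) : Fin 8 → ℝ :=
  ![U 1,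
    U 1 * (U 1 / U 0) - U 4 ^ 2 + mhdTotalPressure γ U,
    U 1 * (U 2 / U 0) - U 4 * U 5,
    U 1 * (U 3 / U 0) - U 4 * U 6,
    0,
    (U 1 / U 0) * U 5 - U 4 * (U 2 / U 0),
    (U 1 / U 0) * U 6 - U 4 * (U 3 / U 0),
    (U 7 + mhdTotalPressure γ U) * (U 1 / U 0) - U 4 * mhdVdotB U]

/-- The ideal MHD flux in the y-direction. -/
def mhdFlux2 (γ : ℝ) (U : Fin 8 → ℝ) : Fin 8 → ℝ :=
  ![U 2,
    U 1 * (U 2 / U 0) - U 4 * U 5,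
    U 2 * (U 2 / U 0) - U 5 ^ 2 + mhdTotalPressure γ U,
    U 2 * (U 3 / U 0) - U 5 * U 6,
    (U 2 / U 0) * U 4 - U 5 * (U 1 / U 0),
    0,
    (U 2 / U 0) * U 6 - U 5 * (U 3 / U 0),
    (U 7 + mhdTotalPressure γ U) * (U 2 / U 0) - U 5 * mhdVdotB U]

/-- Directional flux: `ℓ = 0` is the x-direction, `ℓ = 1` the y-direction. -/
def mhdFlux (γ : ℝ) (ℓ : Fin 2) (U : Fin 8 → ℝ) : Fin 8 → ℝ :=
  if ℓ = 0 then mhdFlux1 γ U else mhdFlux2 γ U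

/-- The Godunov–Powell source vector `Ψ(U) = (0, B, v, v·B)`. -/
def mhdPsi (U : Fin 8 → ℝ) : Fin 8 → ℝ :=
  ![0, U 4, U 5, U 6, U 1 / U 0, U 2 / U 0, U 3 / U 0, mhdVdotB U]

/-- Index of the momentum component in direction `ℓ`. -/
def velIdx : Fin 2 → Fin 8 := ![1, 2]

/-- Index of the magnetic field component in direction `ℓ`. -/
def magIdx : Fin 2 → Fin 8 := ![4, 5]

/-- Velocity component `v_ℓ`. -/
def mhdVel (ℓ : Fin 2) (U : Fin 8 → ℝ) : ℝ := U (velIdx ℓ) / U 0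

/-- The fast magnetosonic speed in direction `ℓ`. -/
def mhdFastSpeed (γ : ℝ) (ℓ : Fin 2) (U : Fin 8 → ℝ) : ℝ :=
  Real.sqrt ((γ * mhdPressure γ U / U 0 + (U 4 ^ 2 + U 5 ^ 2 + U 6 ^ 2) / U 0
      + Real.sqrt ((γ * mhdPressure γ U / U 0 + (U 4 ^ 2 + U 5 ^ 2 + U 6 ^ 2) / U 0) ^ 2
          - 4 * (γ * mhdPressure γ U / U 0) * (U (magIdx ℓ)) ^ 2 / U 0)) / 2)

/-- Spectral radius `ϱ_ℓ(U) = |v_ℓ| + c_{f,ℓ}(U)`. -/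
def mhdSpecRad (γ : ℝ) (ℓ : Fin 2) (U : Fin 8 → ℝ) : ℝ :=
  |mhdVel ℓ U| + mhdFastSpeed γ ℓ U

/-- The quantity `α_{ℓ,*}(U, Ũ)` from the positivity-preserving LLF viscosity bound. -/
def mhdAlphaStar (γ : ℝ) (ℓ : Fin 2) (U V : Fin 8 → ℝ) : ℝ :=
  max |mhdVel ℓ U|
      (|Real.sqrt (U 0) * mhdVel ℓ U + Real.sqrt (V 0) * mhdVel ℓ V| /
        (Real.sqrt (U 0) + Real.sqrt (V 0)))
    + max (mhdFastSpeed γ ℓ U) (mhdFastSpeed γ ℓ V)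
    + Real.sqrt ((U 4 - V 4) ^ 2 + (U 5 - V 5) ^ 2 + (U 6 - V 6) ^ 2) /
        (Real.sqrt (U 0) + Real.sqrt (V 0))

/-- The local Lax–Friedrichs numerical flux
`F̂_ℓ(U,Ũ) = ½ (F_ℓ(U) + F_ℓ(Ũ) − α (Ũ − U))`. -/
def llfFlux (γ : ℝ) (ℓ : Fin 2) (α : ℝ) (U V : Fin 8 → ℝ) : Fin 8 → ℝ :=
  (1 / 2 : ℝ) • (mhdFlux γ ℓ U + mhdFlux γ ℓ V - α • (V - U))

/-- Central discrete divergence `(∇·B̄)ᵢⱼ`. -/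
def discDivB (Δx Δy : ℝ) (Ubar : ℤ → ℤ → Fin 8 → ℝ) (i j : ℤ) : ℝ :=
  (Ubar (i + 1) j 4 - Ubar (i - 1) j 4) / (2 * Δx)
    + (Ubar i (j + 1) 5 - Ubar i (j - 1) 5) / (2 * Δy)

lemma aux_psd (P Q x β y z c1 c2 : ℝ) (hP : 0 ≤ P) (hQ : 0 ≤ Q)
    (h : P * Q = (c1 ^ 2 + c2 ^ 2) * β ^ 2) :
    0 ≤ P * x ^ 2 + 2 * x * β * (c1 * y + c2 * z) + Q * (y ^ 2 + z ^ 2) := by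
  rcases hQ.eq_or_lt with hQ | hQ
  · subst hQ
    have h1 : c1 * β = 0 := by nlinarith [sq_nonneg (c1 * β), sq_nonneg (c2 * β)]
    have h2 : c2 * β = 0 := by nlinarith [sq_nonneg (c1 * β), sq_nonneg (c2 * β)]
    have : P * x ^ 2 + 2 * x * β * (c1 * y + c2 * z) + 0 * (y ^ 2 + z ^ 2)
      = P * x ^ 2 + 2 * x * y * (c1 * β) + 2 * x * z * (c2 * β) := by ring
    rw [this, h1, h2]
    nlinarith [mul_nonneg hP (sq_nonneg x)]
  · have : 0 ≤ Q * (P * x ^ 2 + 2 * x * β * (c1 * y + c2 * z) + Q * (y ^ 2 + z ^ 2)) := by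
      have e : Q * (P * x ^ 2 + 2 * x * β * (c1 * y + c2 * z) + Q * (y ^ 2 + z ^ 2))
        = (β * x * c1 + Q * y) ^ 2 + (β * x * c2 + Q * z) ^ 2 := by
        linear_combination x ^ 2 * h
      rw [e]; positivity
    exact nonneg_of_mul_nonneg_right this hQ

/-- Properties of the fast speed. -/
lemma aux_fast (a β β1 : ℝ) (ha : 0 < a) (h1 : 0 ≤ β1) (h2 : β1 ≤ β) :
    ∃ L : ℝ, 0 < L ∧ Real.sqrt ((a + β + Real.sqrt ((a + β) ^ 2 - 4 * a * β1)) / 2) = L ∧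
      0 ≤ L ^ 2 - a - (β - β1) ∧ 0 ≤ L ^ 2 - β1 ∧
      (L ^ 2 - a - (β - β1)) * (L ^ 2 - β1) = (β - β1) * β1 := by
  have hd : 0 ≤ (a + β) ^ 2 - 4 * a * β1 := by
    nlinarith [sq_nonneg (a - β), mul_nonneg ha.le (sub_nonneg.2 h2)]
  set s := Real.sqrt ((a + β) ^ 2 - 4 * a * β1) with hs
  have hs0 : 0 ≤ s := Real.sqrt_nonneg _
  have hs2 : s ^ 2 = (a + β) ^ 2 - 4 * a * β1 := Real.sq_sqrt hd
  have hpos : 0 < (a + β + s) / 2 := by linarith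
  refine ⟨_, Real.sqrt_pos.2 hpos, rfl, ?_, ?_, ?_⟩
  all_goals rw [Real.sq_sqrt hpos.le]
  · have : |a + β - 2 * β1| ≤ s := by
      apply Real.abs_le_sqrt; nlinarith [mul_nonneg h1 (sub_nonneg.2 h2)]
    have := abs_le.1 this
    linarith
  · have : |a + β - 2 * β1| ≤ s := by
      apply Real.abs_le_sqrt; nlinarith [mul_nonneg h1 (sub_nonneg.2 h2)]
    have := abs_le.1 this
    linarith
  · nlinarith

lemma aux_amgm (k x l : ℝ) (hl : 0 < l) : k * x ≤ l / 2 * x ^ 2 + k ^ 2 / (2 * l) := by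
  have : l / 2 * x ^ 2 + k ^ 2 / (2 * l) - k * x = (l * x - k) ^ 2 / (2 * l) := by
    field_simp; ring
  have h : 0 ≤ (l * x - k) ^ 2 / (2 * l) := by positivity
  linarith

lemma aux_core' (γ ρ p B1 B2 B3 w1 w2 w3 b1 b2 b3 L : ℝ) (hγ : 1 < γ) (hρ : 0 < ρ) (hp : 0 < p)
    (hL : 0 < L)
    (h1 : 0 ≤ L ^ 2 - γ * p / ρ - (B2 ^ 2 + B3 ^ 2) / ρ) (h2 : 0 ≤ L ^ 2 - B1 ^ 2 / ρ)
    (h3 : (L ^ 2 - γ * p / ρ - (B2 ^ 2 + B3 ^ 2) / ρ) * (L ^ 2 - B1 ^ 2 / ρ)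
      = (B2 ^ 2 + B3 ^ 2) / ρ * (B1 ^ 2 / ρ)) :
    p * w1 + w1 * (B2 * b2 + B3 * b3) - B1 * (w2 * b2 + w3 * b3)
      < L * (ρ * (w1 ^ 2 + w2 ^ 2 + w3 ^ 2) / 2 + (b1 ^ 2 + b2 ^ 2 + b3 ^ 2) / 2 + p / (γ - 1)) := by
  have i1 := aux_amgm (w1 * B2 - B1 * w2) b2 L hL
  have i2 := aux_amgm (w1 * B3 - B1 * w3) b3 L hL
  have i3 : p * w1 ≤ L * (p / (2 * γ)) + γ * p * w1 ^ 2 / (2 * L) := by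
    have hg : 0 < γ := by linarith
    have : L * (p / (2 * γ)) + γ * p * w1 ^ 2 / (2 * L) - p * w1
      = p * (L - γ * w1) ^ 2 / (2 * γ * L) := by field_simp; ring
    have h : 0 ≤ p * (L - γ * w1) ^ 2 / (2 * γ * L) := by positivity
    linarith
  have i4 : p / (2 * γ) < p / (γ - 1) :=
    div_lt_div_of_pos_left hp (by linarith) (by linarith)
  have i5 := aux_psd _ _ w1 (B1 / ρ) w2 w3 B2 B3 h1 h2 (by rw [h3]; field_simp)
  have i6 : γ * p * w1 ^ 2 / (2 * L) + (w1 * B2 - B1 * w2) ^ 2 / (2 * L)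
      + (w1 * B3 - B1 * w3) ^ 2 / (2 * L) ≤ L * (ρ * (w1 ^ 2 + w2 ^ 2 + w3 ^ 2) / 2) := by
    have e : L * (ρ * (w1 ^ 2 + w2 ^ 2 + w3 ^ 2) / 2) - (γ * p * w1 ^ 2 / (2 * L)
      + (w1 * B2 - B1 * w2) ^ 2 / (2 * L) + (w1 * B3 - B1 * w3) ^ 2 / (2 * L))
      = ρ / (2 * L) * ((L ^ 2 - γ * p / ρ - (B2 ^ 2 + B3 ^ 2) / ρ) * w1 ^ 2
        + 2 * w1 * (B1 / ρ) * (B2 * w2 + B3 * w3)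
        + (L ^ 2 - B1 ^ 2 / ρ) * (w2 ^ 2 + w3 ^ 2)) := by
      field_simp; ring
    have : 0 ≤ ρ / (2 * L) := by positivity
    have := mul_nonneg this i5
    linarith
  have i7 := mul_lt_mul_of_pos_left i4 hL
  nlinarith [mul_nonneg hL.le (sq_nonneg b1)]

lemma aux_core (γ ρ p B1 B2 B3 w1 w2 w3 b1 b2 b3 L : ℝ) (hγ : 1 < γ) (hρ : 0 < ρ) (hp : 0 < p)
    (hL : 0 < L)
    (h1 : 0 ≤ L ^ 2 - γ * p / ρ - (B2 ^ 2 + B3 ^ 2) / ρ) (h2 : 0 ≤ L ^ 2 - B1 ^ 2 / ρ)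
    (h3 : (L ^ 2 - γ * p / ρ - (B2 ^ 2 + B3 ^ 2) / ρ) * (L ^ 2 - B1 ^ 2 / ρ)
      = (B2 ^ 2 + B3 ^ 2) / ρ * (B1 ^ 2 / ρ)) :
    |p * w1 + w1 * (B2 * b2 + B3 * b3) - B1 * (w2 * b2 + w3 * b3)|
      < L * (ρ * (w1 ^ 2 + w2 ^ 2 + w3 ^ 2) / 2 + (b1 ^ 2 + b2 ^ 2 + b3 ^ 2) / 2 + p / (γ - 1)) := by
  have j1 := aux_core' γ ρ p B1 B2 B3 w1 w2 w3 b1 b2 b3 L hγ hρ hp hL h1 h2 h3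
  have j2 := aux_core' γ ρ p B1 B2 B3 (-w1) (-w2) (-w3) b1 b2 b3 L hγ hρ hp hL h1 h2 h3
  rw [abs_lt]
  constructor
  · simp only [neg_sq] at j2
    linarith
  · exact j1

/-- The cubic term. -/
lemma aux_cubic (r s w u b1 b2 b3 d1 d2 d3 D : ℝ) (hr : 0 < r) (hs : 0 < s)
    (hD : D = Real.sqrt ((b1 - d1) ^ 2 + (b2 - d2) ^ 2 + (b3 - d3) ^ 2) / (r + s)) :
    |(r * w + s * u) / (r + s) * ((b1 ^ 2 + b2 ^ 2 + b3 ^ 2) - (d1 ^ 2 + d2 ^ 2 + d3 ^ 2)) / 2|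
      ≤ D * ((r * w) ^ 2 / 2 + (s * u) ^ 2 / 2
        + (b1 ^ 2 + b2 ^ 2 + b3 ^ 2) / 2 + (d1 ^ 2 + d2 ^ 2 + d3 ^ 2) / 2) := by
  set δ := Real.sqrt ((b1 - d1) ^ 2 + (b2 - d2) ^ 2 + (b3 - d3) ^ 2) with hδ
  set τ := Real.sqrt ((b1 + d1) ^ 2 + (b2 + d2) ^ 2 + (b3 + d3) ^ 2) with hτ
  have hδ0 : 0 ≤ δ := Real.sqrt_nonneg _
  have hτ0 : 0 ≤ τ := Real.sqrt_nonneg _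
  have hδ2 : δ ^ 2 = (b1 - d1) ^ 2 + (b2 - d2) ^ 2 + (b3 - d3) ^ 2 := Real.sq_sqrt (by positivity)
  have hτ2 : τ ^ 2 = (b1 + d1) ^ 2 + (b2 + d2) ^ 2 + (b3 + d3) ^ 2 := Real.sq_sqrt (by positivity)
  have hcs : |(b1 ^ 2 + b2 ^ 2 + b3 ^ 2) - (d1 ^ 2 + d2 ^ 2 + d3 ^ 2)| ≤ δ * τ := by
    apply abs_le_of_sq_le_sq _ (by positivity)
    rw [mul_pow, hδ2, hτ2]
    nlinarith [sq_nonneg ((b1 - d1) * (b2 + d2) - (b2 - d2) * (b1 + d1)),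
      sq_nonneg ((b1 - d1) * (b3 + d3) - (b3 - d3) * (b1 + d1)),
      sq_nonneg ((b3 - d3) * (b2 + d2) - (b2 - d2) * (b3 + d3))]
  have hrs : 0 < r + s := by positivity
  rw [abs_div, abs_mul, abs_div, abs_of_pos hrs, abs_two]
  have hx : |r * w + s * u| * τ ≤ (r * w) ^ 2 + (s * u) ^ 2
        + (b1 ^ 2 + b2 ^ 2 + b3 ^ 2) + (d1 ^ 2 + d2 ^ 2 + d3 ^ 2) := by
    nlinarith [sq_nonneg (|r * w + s * u| - τ), sq_abs (r * w + s * u), sq_nonneg (r * w - s * u),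
      sq_nonneg (b1 - d1), sq_nonneg (b2 - d2), sq_nonneg (b3 - d3)]
  calc _ ≤ |r * w + s * u| / (r + s) * (δ * τ) / 2 := by gcongr
    _ = δ / (r + s) * (|r * w + s * u| * τ) / 2 := by ring
    _ ≤ δ / (r + s) * ((r * w) ^ 2 + (s * u) ^ 2
        + (b1 ^ 2 + b2 ^ 2 + b3 ^ 2) + (d1 ^ 2 + d2 ^ 2 + d3 ^ 2)) / 2 := by gcongr
    _ = _ := by rw [hD]; ring

/-- Final inequality assembly of the pair estimate. -/
lemma aux_assemble (α v u vs g c c' D K K' e e' b b' Q Q' T : ℝ)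
    (hK : 0 ≤ K) (hK' : 0 ≤ K') (he : 0 ≤ e) (he' : 0 ≤ e') (hb : 0 ≤ b) (hb' : 0 ≤ b')
    (hD : 0 ≤ D)
    (h1 : |v| + c + D ≤ α) (h2 : |u| + c' + D ≤ α) (h3 : |g| + c + D ≤ α) (h4 : |g| + c' + D ≤ α)
    (hT : |T| ≤ D * (K + K' + b + b'))
    (hvs : vs * (b - b') = g * (b - b') - T)
    (hQ : |Q| < c * (K + b + e)) (hQ' : |Q'| < c' * (K' + b' + e')) :
    0 < α * ((K + b + e) + (K' + b' + e')) - (v * (K + e) + vs * b + Q)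
      + (u * (K' + e') + vs * b' + Q') := by
  have k1 : 0 ≤ (α - v - c - D) * (K + e) :=
    mul_nonneg (by linarith [le_abs_self v]) (by linarith)
  have k2 : 0 ≤ (α + u - c' - D) * (K' + e') :=
    mul_nonneg (by linarith [neg_abs_le u]) (by linarith)
  have k3 : 0 ≤ (α - g - c - D) * b := mul_nonneg (by linarith [le_abs_self g]) hb
  have k4 : 0 ≤ (α + g - c' - D) * b' := mul_nonneg (by linarith [neg_abs_le g]) hb'
  have := abs_lt.1 hQ
  have := abs_lt.1 hQ'
  have := abs_le.1 hT
  nlinarith [mul_nonneg hD he, mul_nonneg hD he']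

/-- `W · n*`. -/
def auxN (x y z a b c : ℝ) (W : Fin 8 → ℝ) : ℝ :=
  W 0 * (x ^ 2 + y ^ 2 + z ^ 2) / 2 - (W 1 * x + W 2 * y + W 3 * z)
    - (W 4 * a + W 5 * b + W 6 * c) + W 7

lemma aux_N_eq (γ x y z a b c : ℝ) (U : Fin 8 → ℝ) (hγ : 1 < γ) (hU : U ∈ mhdAdmissible γ) :
    auxN x y z a b c U + (a ^ 2 + b ^ 2 + c ^ 2) / 2 =
      U 0 * ((U 1 / U 0 - x) ^ 2 + (U 2 / U 0 - y) ^ 2 + (U 3 / U 0 - z) ^ 2) / 2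
      + ((U 4 - a) ^ 2 + (U 5 - b) ^ 2 + (U 6 - c) ^ 2) / 2 + mhdPressure γ U / (γ - 1) := by
  have h0 : U 0 ≠ 0 := hU.1.ne'
  have hg : γ - 1 ≠ 0 := by linarith
  unfold auxN mhdPressure
  field_simp
  ring

lemma aux_NF_eq (γ x y z a b c : ℝ) (U : Fin 8 → ℝ) (hγ : 1 < γ) (hU : U ∈ mhdAdmissible γ) :
    auxN x y z a b c (mhdFlux1 γ U) - U 4 * (x * a + y * b + z * c)
      + x * ((a ^ 2 + b ^ 2 + c ^ 2) / 2) =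
      U 1 / U 0 * (U 0 * ((U 1 / U 0 - x) ^ 2 + (U 2 / U 0 - y) ^ 2 + (U 3 / U 0 - z) ^ 2) / 2
        + mhdPressure γ U / (γ - 1))
      + x * (((U 4 - a) ^ 2 + (U 5 - b) ^ 2 + (U 6 - c) ^ 2) / 2)
      + (mhdPressure γ U * (U 1 / U 0 - x)
        + (U 1 / U 0 - x) * (U 5 * (U 5 - b) + U 6 * (U 6 - c))
        - U 4 * ((U 2 / U 0 - y) * (U 5 - b) + (U 3 / U 0 - z) * (U 6 - c))) := by
  have h0 : U 0 ≠ 0 := hU.1.ne'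
  have hg : γ - 1 ≠ 0 := by linarith
  simp [auxN, mhdFlux1, mhdTotalPressure, mhdVdotB, mhdPressure]
  field_simp
  ring

lemma aux_fast1 (γ : ℝ) (U : Fin 8 → ℝ) (hγ : 1 < γ) (hU : U ∈ mhdAdmissible γ) :
    0 < mhdFastSpeed γ 0 U ∧
    0 ≤ mhdFastSpeed γ 0 U ^ 2 - γ * mhdPressure γ U / U 0 - (U 5 ^ 2 + U 6 ^ 2) / U 0 ∧
    0 ≤ mhdFastSpeed γ 0 U ^ 2 - U 4 ^ 2 / U 0 ∧
    (mhdFastSpeed γ 0 U ^ 2 - γ * mhdPressure γ U / U 0 - (U 5 ^ 2 + U 6 ^ 2) / U 0)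
      * (mhdFastSpeed γ 0 U ^ 2 - U 4 ^ 2 / U 0)
      = (U 5 ^ 2 + U 6 ^ 2) / U 0 * (U 4 ^ 2 / U 0) := by
  have h0 : 0 < U 0 := hU.1
  have hp : 0 < mhdPressure γ U := hU.2
  obtain ⟨L, hL, hE, h1, h2, h3⟩ := aux_fast (γ * mhdPressure γ U / U 0)
    ((U 4 ^ 2 + U 5 ^ 2 + U 6 ^ 2) / U 0) (U 4 ^ 2 / U 0) (by positivity) (by positivity)
    (by gcongr; nlinarith [sq_nonneg (U 5), sq_nonneg (U 6)])
  have hf : mhdFastSpeed γ 0 U = L := by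
    rw [← hE]
    simp only [mhdFastSpeed, magIdx, Matrix.cons_val_zero, mul_div_assoc]
  have e : (U 4 ^ 2 + U 5 ^ 2 + U 6 ^ 2) / U 0 - U 4 ^ 2 / U 0 = (U 5 ^ 2 + U 6 ^ 2) / U 0 := by
    ring
  rw [e] at h1 h3
  rw [hf]
  exact ⟨hL, h1, h2, h3⟩

/-- the interface condition -/
def auxA (γ : ℝ) (ℓ : Fin 2) (α : ℝ) (U V : Fin 8 → ℝ) : Prop :=
  mhdAlphaStar γ ℓ U V ≤ α ∧ mhdAlphaStar γ ℓ V U ≤ α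

lemma aux_pair1 (γ α x y z a b c : ℝ) (U V : Fin 8 → ℝ) (hγ : 1 < γ) (hU : U ∈ mhdAdmissible γ)
    (hV : V ∈ mhdAdmissible γ) (hA : auxA γ 0 α U V) :
    0 < α * (auxN x y z a b c U + auxN x y z a b c V + (a ^ 2 + b ^ 2 + c ^ 2))
      - auxN x y z a b c (mhdFlux1 γ U) + auxN x y z a b c (mhdFlux1 γ V)
      + (U 4 - V 4) * (x * a + y * b + z * c) := by
  obtain ⟨hA1, hA2⟩ := hA
  have h0 : 0 < U 0 := hU.1
  have hp : 0 < mhdPressure γ U := hU.2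
  have k0 : 0 < V 0 := hV.1
  have kp : 0 < mhdPressure γ V := hV.2
  have hg : 0 < γ - 1 := by linarith
  obtain ⟨f1, f2, f3, f4⟩ := aux_fast1 γ U hγ hU
  obtain ⟨g1, g2, g3, g4⟩ := aux_fast1 γ V hγ hV
  have hr := Real.sqrt_pos.2 h0
  have hs := Real.sqrt_pos.2 k0
  have hr2 := Real.sq_sqrt h0.le
  have hs2 := Real.sq_sqrt k0.le
  have Q1 := aux_core γ (U 0) (mhdPressure γ U) (U 4) (U 5) (U 6) (U 1 / U 0 - x) (U 2 / U 0 - y)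
    (U 3 / U 0 - z) (U 4 - a) (U 5 - b) (U 6 - c) _ hγ h0 hp f1 f2 f3 f4
  have Q2 := aux_core γ (V 0) (mhdPressure γ V) (V 4) (V 5) (V 6) (V 1 / V 0 - x) (V 2 / V 0 - y)
    (V 3 / V 0 - z) (V 4 - a) (V 5 - b) (V 6 - c) _ hγ k0 kp g1 g2 g3 g4
  have C := aux_cubic (√(U 0)) (√(V 0)) (U 1 / U 0 - x) (V 1 / V 0 - x) (U 4 - a) (U 5 - b)
    (U 6 - c) (V 4 - a) (V 5 - b) (V 6 - c) _ hr hs rfl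
  have n1 := aux_N_eq γ x y z a b c U hγ hU
  have n2 := aux_N_eq γ x y z a b c V hγ hV
  have m1 := aux_NF_eq γ x y z a b c U hγ hU
  have m2 := aux_NF_eq γ x y z a b c V hγ hV
  simp only [sub_sub_sub_cancel_right, mul_pow, hr2, hs2] at C
  have e1 : mhdVel 0 U = U 1 / U 0 := by simp [mhdVel, velIdx]
  have e2 : mhdVel 0 V = V 1 / V 0 := by simp [mhdVel, velIdx]
  unfold mhdAlphaStar at hA1 hA2
  rw [e1, e2] at hA1 hA2
  rw [show √(V 0) * (V 1 / V 0) + √(U 0) * (U 1 / U 0)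
      = √(U 0) * (U 1 / U 0) + √(V 0) * (V 1 / V 0) by ring, add_comm (√(V 0)) (√(U 0)),
      show (V 4 - U 4) ^ 2 + (V 5 - U 5) ^ 2 + (V 6 - U 6) ^ 2
        = (U 4 - V 4) ^ 2 + (U 5 - V 5) ^ 2 + (U 6 - V 6) ^ 2 by ring] at hA2
  rw [← abs_of_pos (add_pos hr hs), ← abs_div, abs_of_pos (add_pos hr hs)] at hA1 hA2
  set D := √((U 4 - V 4) ^ 2 + (U 5 - V 5) ^ 2 + (U 6 - V 6) ^ 2) / (√(U 0) + √(V 0)) with hD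
  have hD0 : 0 ≤ D := by positivity
  set g := (√(U 0) * (U 1 / U 0) + √(V 0) * (V 1 / V 0)) / (√(U 0) + √(V 0)) with hgdef
  set fU := mhdFastSpeed γ 0 U
  set fV := mhdFastSpeed γ 0 V
  have A1 := le_max_left |U 1 / U 0| |g|
  have A2 := le_max_right |U 1 / U 0| |g|
  have A3 := le_max_left |V 1 / V 0| |g|
  have A5 := le_max_left fU fV
  have A6 := le_max_right fU fV
  have A7 := le_max_left fV fU
  have F := aux_assemble α (U 1 / U 0) (V 1 / V 0) x g fU fV D
    (U 0 * ((U 1 / U 0 - x) ^ 2 + (U 2 / U 0 - y) ^ 2 + (U 3 / U 0 - z) ^ 2) / 2)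
    (V 0 * ((V 1 / V 0 - x) ^ 2 + (V 2 / V 0 - y) ^ 2 + (V 3 / V 0 - z) ^ 2) / 2)
    (mhdPressure γ U / (γ - 1)) (mhdPressure γ V / (γ - 1))
    (((U 4 - a) ^ 2 + (U 5 - b) ^ 2 + (U 6 - c) ^ 2) / 2)
    (((V 4 - a) ^ 2 + (V 5 - b) ^ 2 + (V 6 - c) ^ 2) / 2) _ _ _
    (by positivity) (by positivity) (by positivity) (by positivity) (by positivity) (by positivity)
    hD0 (by linarith) (by linarith) (by linarith) (by linarith)
    (C.trans (by
      apply mul_le_mul_of_nonneg_left _ hD0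
      have := mul_nonneg h0.le (sq_nonneg (U 2 / U 0 - y))
      have := mul_nonneg h0.le (sq_nonneg (U 3 / U 0 - z))
      have := mul_nonneg k0.le (sq_nonneg (V 2 / V 0 - y))
      have := mul_nonneg k0.le (sq_nonneg (V 3 / V 0 - z))
      linarith))
    (by
      have : x = g - (√(U 0) * (U 1 / U 0 - x) + √(V 0) * (V 1 / V 0 - x)) / (√(U 0) + √(V 0)) := by
        rw [hgdef]
        have := (add_pos hr hs).ne'
        generalize U 1 / U 0 = u1
        generalize V 1 / V 0 = u2
        field_simp
        ring
      linear_combination (((U 4 - a) ^ 2 + (U 5 - b) ^ 2 + (U 6 - c) ^ 2) / 2 -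
        ((V 4 - a) ^ 2 + (V 5 - b) ^ 2 + (V 6 - c) ^ 2) / 2) * this)
    Q1 Q2
  rw [← n1, ← n2, ← m1, ← m2] at F
  linarith

/-- coordinate swap -/
def auxS (U : Fin 8 → ℝ) : Fin 8 → ℝ := ![U 0, U 2, U 1, U 3, U 5, U 4, U 6, U 7]

lemma aux_S_p (γ : ℝ) (U : Fin 8 → ℝ) : mhdPressure γ (auxS U) = mhdPressure γ U := by
  simp [mhdPressure, auxS]; left; ring

lemma aux_S_adm (γ : ℝ) (U : Fin 8 → ℝ) (h : U ∈ mhdAdmissible γ) : auxS U ∈ mhdAdmissible γ :=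
  ⟨h.1, by rw [aux_S_p]; exact h.2⟩

lemma aux_S_fast (γ : ℝ) (U : Fin 8 → ℝ) :
    mhdFastSpeed γ 0 (auxS U) = mhdFastSpeed γ 1 U := by
  unfold mhdFastSpeed
  rw [aux_S_p]
  simp [auxS, magIdx, add_comm (U 5 ^ 2)]

lemma aux_S_star (γ : ℝ) (U V : Fin 8 → ℝ) :
    mhdAlphaStar γ 0 (auxS U) (auxS V) = mhdAlphaStar γ 1 U V := by
  unfold mhdAlphaStar
  rw [aux_S_fast, aux_S_fast]
  simp [auxS, mhdVel, velIdx, add_comm ((U 5 - V 5) ^ 2)]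

lemma aux_S_flux (γ x y z a b c : ℝ) (U : Fin 8 → ℝ) :
    auxN y x z b a c (mhdFlux1 γ (auxS U)) = auxN x y z a b c (mhdFlux2 γ U) := by
  simp only [auxN, mhdFlux1, mhdFlux2, mhdTotalPressure, mhdVdotB, aux_S_p]
  simp [auxS]
  ring

lemma aux_S_N (x y z a b c : ℝ) (U : Fin 8 → ℝ) :
    auxN y x z b a c (auxS U) = auxN x y z a b c U := by
  simp [auxN, auxS]
  ring

lemma aux_pair2 (γ α x y z a b c : ℝ) (U V : Fin 8 → ℝ) (hγ : 1 < γ) (hU : U ∈ mhdAdmissible γ)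
    (hV : V ∈ mhdAdmissible γ) (hA : auxA γ 1 α U V) :
    0 < α * (auxN x y z a b c U + auxN x y z a b c V + (a ^ 2 + b ^ 2 + c ^ 2))
      - auxN x y z a b c (mhdFlux2 γ U) + auxN x y z a b c (mhdFlux2 γ V)
      + (U 5 - V 5) * (x * a + y * b + z * c) := by
  have := aux_pair1 γ α y x z b a c (auxS U) (auxS V) hγ (aux_S_adm γ U hU) (aux_S_adm γ V hV)
    (by unfold auxA; rw [aux_S_star, aux_S_star]; exact hA)
  rw [aux_S_flux, aux_S_flux, aux_S_N, aux_S_N] at this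
  simp only [auxS, Matrix.cons_val] at this
  linarith

/-- velocity bound from the interface condition -/
lemma aux_vel (γ α : ℝ) (ℓ : Fin 2) (U V : Fin 8 → ℝ) (hγ : 1 < γ) (hU : U ∈ mhdAdmissible γ)
    (hV : V ∈ mhdAdmissible γ) (hA : auxA γ ℓ α U V) :
    |mhdVel ℓ U| < α ∧ |mhdVel ℓ V| < α := by
  have key : ∀ W, W ∈ mhdAdmissible γ → 0 < mhdFastSpeed γ ℓ W := by
    intro W hW
    fin_cases ℓ
    · exact (aux_fast1 γ W hγ hW).1
    · have := (aux_fast1 γ _ hγ (aux_S_adm γ W hW)).1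
      rwa [aux_S_fast] at this
  obtain ⟨h1, h2⟩ := hA
  unfold mhdAlphaStar at h1 h2
  constructor
  · have : 0 ≤ √((U 4 - V 4) ^ 2 + (U 5 - V 5) ^ 2 + (U 6 - V 6) ^ 2) / (√(U 0) + √(V 0)) := by
      positivity
    have := key U hU
    have := le_max_left (mhdFastSpeed γ ℓ U) (mhdFastSpeed γ ℓ V)
    have := le_max_left |mhdVel ℓ U| (|√(U 0) * mhdVel ℓ U + √(V 0) * mhdVel ℓ V| /
      (√(U 0) + √(V 0)))
    linarith
  · have : 0 ≤ √((V 4 - U 4) ^ 2 + (V 5 - U 5) ^ 2 + (V 6 - U 6) ^ 2) / (√(V 0) + √(U 0)) := by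
      positivity
    have := key V hV
    have := le_max_left (mhdFastSpeed γ ℓ V) (mhdFastSpeed γ ℓ U)
    have := le_max_left |mhdVel ℓ V| (|√(V 0) * mhdVel ℓ V + √(U 0) * mhdVel ℓ U| /
      (√(V 0) + √(U 0)))
    linarith

/-- density pair positivity: `α (ρ + ρ̃) - m_ℓ + m̃_ℓ > 0`. -/
lemma aux_dens (γ α : ℝ) (ℓ : Fin 2) (U V : Fin 8 → ℝ) (hγ : 1 < γ) (hU : U ∈ mhdAdmissible γ)
    (hV : V ∈ mhdAdmissible γ) (hA : auxA γ ℓ α U V) :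
    0 < α * (U 0 + V 0) - U (velIdx ℓ) + V (velIdx ℓ) := by
  obtain ⟨h1, h2⟩ := aux_vel γ α ℓ U V hγ hU hV hA
  have h0 : 0 < U 0 := hU.1
  have k0 : 0 < V 0 := hV.1
  have e1 : U (velIdx ℓ) = mhdVel ℓ U * U 0 := by unfold mhdVel; field_simp
  have e2 : V (velIdx ℓ) = mhdVel ℓ V * V 0 := by unfold mhdVel; field_simp
  rw [e1, e2]
  have := mul_pos (sub_pos.2 ((le_abs_self _).trans_lt h1)) h0
  have := mul_pos (by linarith [(neg_le_of_abs_le h2.le), (abs_lt.1 h2).1] :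
    0 < α + mhdVel ℓ V) k0
  nlinarith

/-- source term bound -/
lemma aux_src (γ x y z a b c d : ℝ) (U : Fin 8 → ℝ) (hγ : 1 < γ) (hU : U ∈ mhdAdmissible γ) :
    d * (auxN x y z a b c (mhdPsi U) + (x * a + y * b + z * c))
      ≤ |d| / √(U 0) * (auxN x y z a b c U + (a ^ 2 + b ^ 2 + c ^ 2) / 2) := by
  have h0 : 0 < U 0 := hU.1
  have hp : 0 < mhdPressure γ U := hU.2
  have hg : 0 < γ - 1 := by linarith
  have hr := Real.sqrt_pos.2 h0
  have hr2 := Real.sq_sqrt h0.le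
  rw [aux_N_eq γ x y z a b c U hγ hU]
  have e : auxN x y z a b c (mhdPsi U) + (x * a + y * b + z * c)
    = (U 1 / U 0 - x) * (U 4 - a) + (U 2 / U 0 - y) * (U 5 - b) + (U 3 / U 0 - z) * (U 6 - c) := by
    simp [auxN, mhdPsi, mhdVdotB]
    ring
  rw [e]
  have hpg : 0 ≤ mhdPressure γ U / (γ - 1) := by positivity
  generalize mhdPressure γ U / (γ - 1) = e at *
  generalize U 1 / U 0 - x = w1
  generalize U 2 / U 0 - y = w2
  generalize U 3 / U 0 - z = w3
  generalize U 4 - a = b1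
  generalize U 5 - b = b2
  generalize U 6 - c = b3
  rw [← hr2]
  generalize √(U 0) = r at *
  rw [Real.sqrt_sq hr.le]
  calc _ ≤ |d * (w1 * b1 + w2 * b2 + w3 * b3)| := le_abs_self _
    _ = |d| * |w1 * b1 + w2 * b2 + w3 * b3| := abs_mul _ _
    _ ≤ |d| * ((r ^ 2 * (w1 ^ 2 + w2 ^ 2 + w3 ^ 2) / 2 + (b1 ^ 2 + b2 ^ 2 + b3 ^ 2) / 2 + e) / r) := by
      gcongr
      rw [le_div_iff₀ hr]
      rcases abs_cases (w1 * b1 + w2 * b2 + w3 * b3) with ⟨h, _⟩ | ⟨h, _⟩ <;> rw [h]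
      · nlinarith [sq_nonneg (r * w1 - b1), sq_nonneg (r * w2 - b2), sq_nonneg (r * w3 - b3)]
      · nlinarith [sq_nonneg (r * w1 + b1), sq_nonneg (r * w2 + b2), sq_nonneg (r * w3 + b3)]
    _ = _ := by ring

lemma aux_N_add (x y z a b c : ℝ) (U V : Fin 8 → ℝ) :
    auxN x y z a b c (U + V) = auxN x y z a b c U + auxN x y z a b c V := by
  simp [auxN]; ring

lemma aux_N_sub (x y z a b c : ℝ) (U V : Fin 8 → ℝ) :
    auxN x y z a b c (U - V) = auxN x y z a b c U - auxN x y z a b c V := by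
  simp [auxN]; ring

lemma aux_N_smul (x y z a b c k : ℝ) (U : Fin 8 → ℝ) :
    auxN x y z a b c (k • U) = k * auxN x y z a b c U := by
  simp [auxN]; ring

lemma aux_adm_of (γ : ℝ) (W : Fin 8 → ℝ) (hγ : 1 < γ) (h0 : 0 < W 0)
    (h : ∀ x y z a b c : ℝ, 0 < auxN x y z a b c W + (a ^ 2 + b ^ 2 + c ^ 2) / 2) :
    W ∈ mhdAdmissible γ := by
  refine ⟨h0, ?_⟩
  have := h (W 1 / W 0) (W 2 / W 0) (W 3 / W 0) (W 4) (W 5) (W 6)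
  unfold mhdPressure
  apply mul_pos (by linarith)
  refine lt_of_lt_of_eq this ?_
  unfold auxN
  field_simp
  ring

lemma aux_update (γ Δt Δx Δy : ℝ) (hγ : 1 < γ) (hΔt : 0 < Δt) (hΔx : 0 < Δx) (hΔy : 0 < Δy)
    (C R L T S : Fin 8 → ℝ) (hC : C ∈ mhdAdmissible γ) (hR : R ∈ mhdAdmissible γ)
    (hL : L ∈ mhdAdmissible γ) (hT : T ∈ mhdAdmissible γ) (hS : S ∈ mhdAdmissible γ)
    (αR αL αT αS d : ℝ) (aR : auxA γ 0 αR R C) (aL : auxA γ 0 αL C L)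
    (aT : auxA γ 1 αT T C) (aS : auxA γ 1 αS C S)
    (hd : d = (R 4 - L 4) / (2 * Δx) + (T 5 - S 5) / (2 * Δy))
    (hCFL : Δt * (αL / Δx + αR / Δx + αS / Δy + αT / Δy + |d| / √(C 0)) ≤ 1) :
    C - (Δt / Δx) • (llfFlux γ 0 αR C R - llfFlux γ 0 αL L C)
      - (Δt / Δy) • (llfFlux γ 1 αT C T - llfFlux γ 1 αS S C)
      - (Δt * d) • mhdPsi C ∈ mhdAdmissible γ := by
  have hlx : 0 < Δt / Δx := by positivity
  have hly : 0 < Δt / Δy := by positivity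
  have hdd : Δt * d = Δt / Δx / 2 * (R 4 - L 4) + Δt / Δy / 2 * (T 5 - S 5) := by
    rw [hd]; field_simp
  have hC0 : 0 < C 0 := hC.1
  have hcfl : 0 ≤ 1 - Δt / Δx * (αL + αR) - Δt / Δy * (αS + αT) - Δt * (|d| / √(C 0)) := by
    have : Δt * (αL / Δx + αR / Δx + αS / Δy + αT / Δy + |d| / √(C 0))
      = Δt / Δx * (αL + αR) + Δt / Δy * (αS + αT) + Δt * (|d| / √(C 0)) := by ring
    linarith
  have hsrc0 : 0 ≤ Δt * (|d| / √(C 0)) := by positivity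
  have f0 : ∀ W, mhdFlux γ 0 W = mhdFlux1 γ W := fun W => by simp [mhdFlux]
  have f1 : ∀ W, mhdFlux γ 1 W = mhdFlux2 γ W := fun W => by simp [mhdFlux]
  apply aux_adm_of γ _ hγ
  · have p1 := mul_pos hlx (aux_dens γ αR 0 R C hγ hR hC aR)
    have p2 := mul_pos hlx (aux_dens γ αL 0 C L hγ hC hL aL)
    have p3 := mul_pos hly (aux_dens γ αT 1 T C hγ hT hC aT)
    have p4 := mul_pos hly (aux_dens γ αS 1 C S hγ hC hS aS)
    have p5 := mul_nonneg hcfl hC0.le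
    have p6 := mul_nonneg hsrc0 hC0.le
    simp only [velIdx, Matrix.cons_val_zero, Matrix.cons_val_one] at p1 p2 p3 p4
    have q1 : ∀ W, mhdFlux1 γ W 0 = W 1 := fun W => rfl
    have q2 : ∀ W, mhdFlux2 γ W 0 = W 2 := fun W => rfl
    have q3 : ∀ W, mhdPsi W 0 = 0 := fun W => rfl
    simp only [llfFlux, f0, f1, Pi.sub_apply, Pi.add_apply, Pi.smul_apply, smul_eq_mul, q1, q2, q3]
    nlinarith
  · intro x y z a b c
    have p1 := mul_pos hlx (aux_pair1 γ αR x y z a b c R C hγ hR hC aR)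
    have p2 := mul_pos hlx (aux_pair1 γ αL x y z a b c C L hγ hC hL aL)
    have p3 := mul_pos hly (aux_pair2 γ αT x y z a b c T C hγ hT hC aT)
    have p4 := mul_pos hly (aux_pair2 γ αS x y z a b c C S hγ hC hS aS)
    have p5 := mul_le_mul_of_nonneg_left (aux_src γ x y z a b c d C hγ hC) hΔt.le
    have hX : 0 ≤ auxN x y z a b c C + (a ^ 2 + b ^ 2 + c ^ 2) / 2 := by
      rw [aux_N_eq γ x y z a b c C hγ hC]
      have := hC.2
      have : 0 < γ - 1 := by linarith
      have : 0 ≤ mhdPressure γ C / (γ - 1) := by have := hC.2; positivity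
      positivity
    have p6 := mul_nonneg hcfl hX
    simp only [llfFlux, f0, f1, aux_N_add, aux_N_sub, aux_N_smul]
    have hv : Δt * d * (x * a + y * b + z * c) = (Δt / Δx / 2 * (R 4 - L 4)
      + Δt / Δy / 2 * (T 5 - S 5)) * (x * a + y * b + z * c) := by rw [hdd]
    generalize auxN x y z a b c C = NC at *
    generalize |d| / √(C 0) = dd at *
    linarith

/-- Positivity preservation of the first-order LLF scheme with Godunov–Powell source:
under the stated viscosity bounds and CFL condition, the updated cell averages
remain in the admissible set `𝒢`. -/
theorem llf_scheme_positivity_preserving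
    (γ : ℝ) (hγ : 1 < γ)
    (Δt Δx Δy : ℝ) (hΔt : 0 < Δt) (hΔx : 0 < Δx) (hΔy : 0 < Δy)
    (Ubar : ℤ → ℤ → Fin 8 → ℝ)
    (hG : ∀ i j : ℤ, Ubar i j ∈ mhdAdmissible γ)
    (α1 α2 : ℤ → ℤ → ℝ)
    (hα1 : ∀ i j : ℤ,
      max (max (mhdSpecRad γ 0 (Ubar i j)) (mhdSpecRad γ 0 (Ubar (i + 1) j)))
          (max (mhdAlphaStar γ 0 (Ubar i j) (Ubar (i + 1) j))
               (mhdAlphaStar γ 0 (Ubar (i + 1) j) (Ubar i j))) ≤ α1 i j)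
    (hα2 : ∀ i j : ℤ,
      max (max (mhdSpecRad γ 1 (Ubar i j)) (mhdSpecRad γ 1 (Ubar i (j + 1))))
          (max (mhdAlphaStar γ 1 (Ubar i j) (Ubar i (j + 1)))
               (mhdAlphaStar γ 1 (Ubar i (j + 1)) (Ubar i j))) ≤ α2 i j)
    (hCFL : ∀ i j : ℤ,
      Δt * (α1 (i - 1) j / Δx + α1 i j / Δx + α2 i (j - 1) / Δy + α2 i j / Δy
        + |discDivB Δx Δy Ubar i j| / Real.sqrt (Ubar i j 0)) ≤ 1) :
    ∀ i j : ℤ,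
      (Ubar i j
        - (Δt / Δx) • (llfFlux γ 0 (α1 i j) (Ubar i j) (Ubar (i + 1) j)
            - llfFlux γ 0 (α1 (i - 1) j) (Ubar (i - 1) j) (Ubar i j))
        - (Δt / Δy) • (llfFlux γ 1 (α2 i j) (Ubar i j) (Ubar i (j + 1))
            - llfFlux γ 1 (α2 i (j - 1)) (Ubar i (j - 1)) (Ubar i j))
        - (Δt * discDivB Δx Δy Ubar i j) • mhdPsi (Ubar i j)) ∈ mhdAdmissible γ := by
  intro i j
  refine aux_update γ Δt Δx Δy hγ hΔt hΔx hΔy (Ubar i j) (Ubar (i + 1) j) (Ubar (i - 1) j)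
    (Ubar i (j + 1)) (Ubar i (j - 1)) (hG _ _) (hG _ _) (hG _ _) (hG _ _) (hG _ _)
    (α1 i j) (α1 (i - 1) j) (α2 i j) (α2 i (j - 1)) (discDivB Δx Δy Ubar i j)
    ?_ ?_ ?_ ?_ rfl (hCFL i j)
  · have h := max_le_iff.1 ((le_max_right _ _).trans (hα1 i j))
    exact ⟨h.2, h.1⟩
  · have h := hα1 (i - 1) j
    rw [sub_add_cancel] at h
    have h := max_le_iff.1 ((le_max_right _ _).trans h)
    exact ⟨h.2, h.1⟩
  · have h := max_le_iff.1 ((le_max_right _ _).trans (hα2 i j))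
    exact ⟨h.2, h.1⟩
  · have h := hα2 i (j - 1)
    rw [sub_add_cancel] at h
    have h := max_le_iff.1 ((le_max_right _ _).trans h)
    exact ⟨h.2, h.1⟩

end
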